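/- Suppose F : K → L²(Ω) is Lipschitz and sticking. Then every Lagrangian solution X with initial data (X̄, V̄) such that X̄ ∈ K and V̄ ∈ H_{X̄} is sticky, i.e. Ω_{X(t₁)} ⊆ Ω_{X(t₂)} whenever 0 ≤ t₁ ≤ t₂. -/

import Mathlib

open MeasureTheory Set Filter
open scoped ENNReal NNReal RealInnerProductSpace

noncomputable section

/-- The interval `Ω = (0,1)`. -/
def Omg : Set ℝ := Set.Ioo 0 1

/-- Lebesgue measure restricted to `(0,1)`. -/
def mu : Measure ℝ := volume.restrict Omg

/-- The Hilbert space `L²(Ω)`. -/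
abbrev L2 : Type := Lp ℝ 2 mu

/-- The cone `K` of functions in `L²(Ω)` admitting a nondecreasing representative. -/
def Kcone : Set L2 := {X | ∃ g : ℝ → ℝ, MonotoneOn g Omg ∧ ⇑X =ᵐ[mu] g}

/-- The normal cone to `K` at `X`. -/
def normalCone (X : L2) : Set L2 := {W | ∀ Y ∈ Kcone, ⟪W, Y - X⟫ ≤ 0}

/-- `Ω_X`: points of `Ω` near which `X` is (essentially) constant. -/
def OmegaX (X : L2) : Set ℝ :=
  {m | m ∈ Omg ∧ ∃ U ∈ nhds m, ∃ c : ℝ, ∀ᵐ x ∂(mu.restrict U), X x = c}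

/-- The closed subspace `H_X` of functions admitting a representative that is constant on
each connected component of `Ω_X`. -/
def HX (X : L2) : Set L2 :=
  {U | ∃ g : ℝ → ℝ, ⇑U =ᵐ[mu] g ∧
    ∀ m ∈ OmegaX X, ∀ m' ∈ connectedComponentIn (OmegaX X) m, g m' = g m}

/-- `P` is the orthogonal projection of `V` onto `H_X`. -/
def IsProjHX (X V P : L2) : Prop := P ∈ HX X ∧ ∀ U ∈ HX X, ⟪V - P, U⟫ = 0

/-- `F` is sticking: for all `X, Y ∈ K` with `Y ∈ H_X`,
`F[X] − P_{H_X}(F[X]) ∈ N_Y K`. -/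
def Sticking (F : L2 → L2) : Prop :=
  ∀ X ∈ Kcone, ∀ Y ∈ Kcone, Y ∈ HX X →
    ∀ P : L2, IsProjHX X (F X) P → F X - P ∈ normalCone Y

/-- A Lagrangian solution with initial data `(X̄, V̄)`. -/
def LagSol (F : L2 → L2) (Xbar Vbar : L2) (X : ℝ → L2) : Prop :=
  (∀ t : ℝ, 0 ≤ t → X t ∈ Kcone) ∧ X 0 = Xbar ∧
  (∀ T : ℝ, ∃ L : ℝ≥0, LipschitzOnWith L X (Set.Icc 0 T)) ∧
  (∀ᵐ t ∂(volume.restrict (Set.Ioi (0:ℝ))),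
    ∃ V : L2, HasDerivAt X V t ∧
      (Vbar + ∫ s in Set.Ioc (0:ℝ) t, F (X s)) - V ∈ normalCone (X t))

/-- A Lipschitz function whose derivative is almost everywhere at most `B` grows at most at
rate `B`. -/
theorem sub_le_mul_of_ae_hasDerivAt_le {f : ℝ → ℝ} {a b B : ℝ} {k : ℝ≥0} (hab : a ≤ b)
    (hf : LipschitzOnWith k f (Icc a b))
    (hd : ∀ᵐ x, x ∈ Ioo a b → ∃ f', HasDerivAt f f' x ∧ f' ≤ B) :
    f b - f a ≤ B * (b - a) := by
  have hac : AbsolutelyContinuousOnInterval f a b :=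
    LipschitzOnWith.absolutelyContinuousOnInterval (by rwa [uIcc_of_le hab])
  rw [← hac.integral_deriv_eq_sub]
  have hc : ∫ _ in a..b, B = B * (b - a) := by simp [mul_comm]
  rw [← hc]
  refine intervalIntegral.integral_mono_ae_restrict hab hac.intervalIntegrable_deriv
    intervalIntegrable_const ?_
  rw [← restrict_Ioo_eq_restrict_Icc]
  filter_upwards [(ae_restrict_iff' measurableSet_Ioo).2 hd] with x ⟨f', h1, h2⟩
  rwa [h1.deriv]

section Abstract

variable {E : Type*} [NormedAddCommGroup E] [InnerProductSpace ℝ E]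

/-- A closed convex set `K` and closed subspaces `H x` that interact like the cone of monotone
functions and the functions that are constant wherever `x` is. -/
structure IsStickyFamily (K : Set E) (H : E → Submodule ℝ E)
    [∀ x, (H x).HasOrthogonalProjection] : Prop where
  closed : IsClosed K
  convex : Convex ℝ K
  nonempty : K.Nonempty
  mem_self : ∀ x ∈ K, x ∈ H x
  proj_mem : ∀ x ∈ K, ∀ z ∈ K, (H x).starProjection z ∈ K
  inner_nonneg : ∀ x ∈ K, ∀ z ∈ K, ∀ w ∈ K, 0 ≤ ⟪w, z - (H x).starProjection z⟫
  normal_le : ∀ x ∈ K, ∀ n, (∀ z ∈ K, ⟪n, z - x⟫ ≤ 0) → ∀ z ∈ K, ⟪n, z⟫ ≤ 0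
  normal_proj : ∀ x ∈ K, ∀ n, (∀ z ∈ K, ⟪n, z - x⟫ ≤ 0) → ∀ z ∈ K,
    ⟪n, (H x).starProjection z⟫ = 0
  mono : ∀ x ∈ K, ∀ x' ∈ K, x' ∈ H x → H x' ≤ H x

/-- The component of `y` orthogonal to `H x` lies in the polar cone of `K`. -/
def IsAdmissible (K : Set E) (H : E → Submodule ℝ E) [∀ x, (H x).HasOrthogonalProjection]
    (x y : E) : Prop :=
  ∀ z ∈ K, ⟪y, z - (H x).starProjection z⟫ ≤ 0

/-- The properties on `[0, T]` of a Lagrangian solution `X` with unprojected velocity `Y`. -/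
structure IsLagrangianOn (K : Set E) (F : E → E) (X Y : ℝ → E) (T M : ℝ) : Prop where
  one_le : 1 ≤ M
  mem : ∀ t ∈ Icc 0 T, X t ∈ K
  lip_pos : ∀ s ∈ Icc 0 T, ∀ t ∈ Icc 0 T, ‖X s - X t‖ ≤ M * |s - t|
  lip_vel : ∀ s ∈ Icc 0 T, ∀ t ∈ Icc 0 T, ‖Y s - Y t‖ ≤ M * |s - t|
  norm_vel_le : ∀ t ∈ Icc 0 T, ‖Y t‖ ≤ M
  lip_force : ∀ x ∈ K, ∀ y ∈ K, ‖F x - F y‖ ≤ M * ‖x - y‖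
  vel_sub_le : ∀ s t, 0 ≤ s → s ≤ t → t ≤ T → ∀ x ∈ K, ∀ δ : ℝ,
    (∀ q ∈ Icc s t, ‖F (X q) - F x‖ ≤ δ) → ‖Y t - Y s - (t - s) • F x‖ ≤ (t - s) * δ
  deriv : ∀ᵐ t, t ∈ Ioo 0 T → ∃ V : E, HasDerivAt X V t ∧
    ∀ z ∈ K, ⟪Y t - V, z - X t⟫ ≤ 0

variable {K : Set E} {H : E → Submodule ℝ E} [∀ x, (H x).HasOrthogonalProjection]

theorem sub_starProjection_inner_eq_zero (U : Submodule ℝ E) [U.HasOrthogonalProjection]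
    (z : E) {u : E} (hu : u ∈ U) : ⟪u, z - U.starProjection z⟫ = 0 :=
  (U.sub_starProjection_mem_orthogonal z) u hu

theorem inner_sub_starProjection_comm (U : Submodule ℝ E) [U.HasOrthogonalProjection]
    (y z : E) : ⟪y - U.starProjection y, z⟫ = ⟪y, z - U.starProjection z⟫ := by
  rw [inner_sub_left, inner_sub_right, U.inner_starProjection_left_eq_right]

theorem IsStickyFamily.normal_sub_le (hK : IsStickyFamily K H) {x n : E} (hx : x ∈ K)
    (hn : ∀ z ∈ K, ⟪n, z - x⟫ ≤ 0) {z : E} (hz : z ∈ K) :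
    ⟪n, z - (H x).starProjection z⟫ ≤ 0 := by
  rw [inner_sub_right, hK.normal_proj x hx n hn z hz, sub_zero]
  exact hK.normal_le x hx n hn z hz

theorem IsStickyFamily.mem_of_isAdmissible (hK : IsStickyFamily K H) {x y x' : E} {h : ℝ}
    (hh : 0 ≤ h) (hx : x ∈ K) (hx' : x' ∈ K) (hy : IsAdmissible K H x y)
    (hn : ∀ z ∈ K, ⟪x + h • y - x', z - x'⟫ ≤ 0) : x' ∈ H x := by
  have h1 := hn _ (hK.proj_mem x hx x' hx')
  have h2 := hy x' hx'
  have h3 := sub_starProjection_inner_eq_zero (H x) x' (hK.mem_self x hx)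
  have h4 := sub_starProjection_inner_eq_zero (H x) x' ((H x).starProjection_apply_mem x')
  have h5 : ⟪x' - (H x).starProjection x', x' - (H x).starProjection x'⟫ ≤ 0 := by
    have e1 : ⟪x + h • y - x', (H x).starProjection x' - x'⟫
        = -⟪x, x' - (H x).starProjection x'⟫ - h * ⟪y, x' - (H x).starProjection x'⟫
          + ⟪x', x' - (H x).starProjection x'⟫ := by
      rw [← neg_sub x' ((H x).starProjection x'), inner_neg_right, inner_sub_left,
        inner_add_left, real_inner_smul_left]
      ring
    rw [inner_sub_left, h4]
    have : h * ⟪y, x' - (H x).starProjection x'⟫ ≤ 0 := mul_nonpos_of_nonneg_of_nonpos hh h2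
    linarith
  have h6 : x' - (H x).starProjection x' = 0 :=
    inner_self_eq_zero.1 (le_antisymm h5 real_inner_self_nonneg)
  rw [sub_eq_zero.1 h6]
  exact (H x).starProjection_apply_mem x'

theorem IsStickyFamily.isAdmissible_of_isAdmissible (hK : IsStickyFamily K H) {x y x' : E}
    {h : ℝ} (hh : 0 < h) (hx : x ∈ K) (hx' : x' ∈ K)
    (hn : ∀ z ∈ K, ⟪x + h • y - x', z - x'⟫ ≤ 0) : IsAdmissible K H x' y := by
  intro z hz
  have h1 := hK.normal_sub_le hx' hn hz
  have h2 := hK.inner_nonneg x' hx' z hz x hx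
  have h3 := sub_starProjection_inner_eq_zero (H x') z (hK.mem_self x' hx')
  rw [inner_sub_left, inner_add_left, real_inner_smul_left, h3] at h1
  by_contra! hc
  have := mul_pos hh hc
  linarith

/-- One step of the discrete scheme approximates the solution to second order in the step. -/
theorem real_error_step {a a' b b' h M : ℝ} (hM : 1 ≤ M) (hh : 0 < h)
    (hC : 10 * M ^ 2 * h ≤ 1 / 2) (ha : 0 ≤ a) (ha' : 0 ≤ a') (hb : 0 ≤ b) (hb' : 0 ≤ b')
    (h1 : a' ^ 2 ≤ a ^ 2 + 2 * h * (b * a') + 2 * h ^ 2 * (3 * M ^ 2 + M * b + M * a))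
    (h2 : b' ≤ b + h * M * (M * h + a')) :
    a' ^ 2 + b' ^ 2 ≤ (1 + 4 * (10 * M ^ 2) * h) * (a ^ 2 + b ^ 2)
      + 2 * (10 * M ^ 2) * h ^ 2 := by
  have hM2 : M ≤ M ^ 2 := by nlinarith
  have hM1 : 1 ≤ M ^ 2 := by nlinarith
  have hh1 : h ≤ 1 := by nlinarith
  have hh2 : h ^ 2 ≤ h := by nlinarith
  have e1 : b' ^ 2 - b ^ 2 ≤ h * M ^ 2 * (h + 2 * (a ^ 2 + b ^ 2 + a' ^ 2 + b' ^ 2)) := by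
    have i1 : b' ^ 2 - b ^ 2 ≤ h * M * (M * h + a') * (b' + b) := by
      nlinarith [mul_le_mul_of_nonneg_right h2 (add_nonneg hb' hb)]
    have i2 : h * M * (M * h + a') ≤ h * M ^ 2 * (h + a') := by
      nlinarith [mul_nonneg hh.le (mul_nonneg ha' (sub_nonneg.2 hM2))]
    have i3 := mul_le_mul_of_nonneg_right i2 (add_nonneg hb' hb)
    have i4 : (h + a') * (b' + b) ≤ h + 2 * (a ^ 2 + b ^ 2 + a' ^ 2 + b' ^ 2) := by
      nlinarith [sq_nonneg (h - b'), sq_nonneg (h - b), sq_nonneg (a' - b'), sq_nonneg (a' - b)]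
    have i5 := mul_le_mul_of_nonneg_left i4 (by positivity : 0 ≤ h * M ^ 2)
    linarith
  have e2 : a' ^ 2 - a ^ 2 ≤ h * M ^ 2 * (8 * h + 2 * (a ^ 2 + b ^ 2 + a' ^ 2 + b' ^ 2)) := by
    have i1 : b * a' ≤ M ^ 2 * ((b ^ 2 + a' ^ 2) / 2) := by
      nlinarith [sq_nonneg (b - a'), mul_nonneg (sub_nonneg.2 hM1) (add_nonneg (sq_nonneg b)
        (sq_nonneg a'))]
    have i2 : 3 * M ^ 2 + M * b + M * a ≤ M ^ 2 * (3 + b + a) := by nlinarith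
    have i3 : h * (3 + b + a) ≤ 4 * h + (a ^ 2 + b ^ 2) / 2 := by
      nlinarith [sq_nonneg (h - a), sq_nonneg (h - b)]
    have i4 := mul_le_mul_of_nonneg_left i1 (by positivity : 0 ≤ 2 * h)
    have i5 := mul_le_mul_of_nonneg_left i2 (by positivity : 0 ≤ 2 * h ^ 2)
    have i6 := mul_le_mul_of_nonneg_left i3 (by positivity : 0 ≤ 2 * h * M ^ 2)
    have i7 : 0 ≤ h * M ^ 2 * (a' ^ 2 + a ^ 2 + 2 * b' ^ 2) := by positivity
    nlinarith
  set D := 10 * M ^ 2 with hD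
  have e3 : (1 - D * h) * (a' ^ 2 + b' ^ 2) ≤ (1 + D * h) * (a ^ 2 + b ^ 2) + D * h ^ 2 := by
    have : 0 ≤ h * M ^ 2 * (h + 6 * (a ^ 2 + b ^ 2 + a' ^ 2 + b' ^ 2)) := by positivity
    nlinarith
  have e4 : 0 < 1 - D * h := by linarith
  have hDh : 0 ≤ D * h := by positivity
  refine le_of_mul_le_mul_left (e3.trans ?_) e4
  have e5 : 0 ≤ (a ^ 2 + b ^ 2) * (D * h * (2 - 4 * (D * h))) := by
    apply mul_nonneg (by positivity) (mul_nonneg hDh (by linarith))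
  have e6 : 0 ≤ D * h ^ 2 * (1 - 2 * (D * h)) := by
    apply mul_nonneg (by positivity) (by linarith)
  nlinarith

variable {F : E → E} {X Y : ℝ → E} {T M : ℝ}

theorem IsLagrangianOn.norm_sq_sub_le (hX : IsLagrangianOn K F X Y T M) {s t : ℝ} (hs : 0 ≤ s)
    (hst : s ≤ t) (ht : t ≤ T) {w : E} (hw : w ∈ K) :
    ‖X t - w‖ ^ 2 - ‖X s - w‖ ^ 2 ≤ 2 * (⟪Y s, X t - w⟫ +
      M * (t - s) * (‖X s - w‖ + M * (t - s)) + M * (M * (t - s))) * (t - s) := by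
  have hM0 : 0 ≤ M := zero_le_one.trans hX.one_le
  have hsub : ∀ q ∈ Icc s t, q ∈ Icc 0 T := fun q hq => ⟨hs.trans hq.1, hq.2.trans ht⟩
  have hsm := hsub s ⟨le_rfl, hst⟩
  have htm := hsub t ⟨hst, le_rfl⟩
  have hbd : ∀ q ∈ Icc s t, ‖X q - w‖ ≤ ‖X s - w‖ + M * (t - s) := by
    intro q hq
    have h1 := hX.lip_pos q (hsub q hq) s hsm
    rw [abs_of_nonneg (sub_nonneg.2 hq.1)] at h1
    have h2 : ‖X q - w‖ ≤ ‖X q - X s‖ + ‖X s - w‖ := norm_sub_le_norm_sub_add_norm_sub _ _ _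
    have := mul_le_mul_of_nonneg_left (sub_le_sub_right hq.2 s) hM0
    linarith
  set R := ‖X s - w‖ + M * (t - s) with hR
  have hR0 : 0 ≤ R := (norm_nonneg _).trans (hbd s ⟨le_rfl, hst⟩)
  have hlip : LipschitzOnWith (Real.toNNReal (2 * R * M)) (fun q => ‖X q - w‖ ^ 2)
      (Icc s t) := by
    refine LipschitzOnWith.of_dist_le_mul fun q hq q' hq' => ?_
    rw [Real.coe_toNNReal _ (by positivity), Real.dist_eq, Real.dist_eq]
    have h1 := hX.lip_pos q (hsub q hq) q' (hsub q' hq')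
    have h2 : |‖X q - w‖ - ‖X q' - w‖| ≤ ‖X q - X q'‖ := by
      simpa using abs_norm_sub_norm_le (X q - w) (X q' - w)
    have h3 : ‖X q - w‖ ^ 2 - ‖X q' - w‖ ^ 2
        = (‖X q - w‖ - ‖X q' - w‖) * (‖X q - w‖ + ‖X q' - w‖) := by ring
    rw [h3, abs_mul, abs_of_nonneg (add_nonneg (norm_nonneg (X q - w)) (norm_nonneg (X q' - w)))]
    calc _ ≤ (M * |q - q'|) * (R + R) :=
          mul_le_mul (h2.trans h1) (add_le_add (hbd q hq) (hbd q' hq')) (by positivity)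
            (by positivity)
      _ = _ := by ring
  refine sub_le_mul_of_ae_hasDerivAt_le hst hlip ?_
  filter_upwards [hX.deriv] with q hq hqst
  obtain ⟨V, hV, hN⟩ := hq ⟨hs.trans_lt hqst.1, hqst.2.trans_le ht⟩
  have hqm : q ∈ Icc s t := Ioo_subset_Icc_self hqst
  refine ⟨_, (hV.sub_const w).norm_sq, ?_⟩
  have h1 := hN w hw
  have h2 : ⟪X q - w, V⟫ ≤ ⟪Y q, X q - w⟫ := by
    rw [← neg_sub (X q) w, inner_neg_right, inner_sub_left] at h1
    rw [real_inner_comm]; linarith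
  have h3 : ⟪Y q, X q - w⟫ = ⟪Y q - Y s, X q - w⟫ + ⟪Y s, X q - X t⟫ + ⟪Y s, X t - w⟫ := by
    simp only [inner_sub_left, inner_sub_right]; ring
  have h4 : ⟪Y q - Y s, X q - w⟫ ≤ M * (t - s) * R := by
    refine (real_inner_le_norm _ _).trans (mul_le_mul ?_ (hbd q hqm) (norm_nonneg _) ?_)
    · refine (hX.lip_vel q (hsub q hqm) s hsm).trans (mul_le_mul_of_nonneg_left ?_ hM0)
      rw [abs_of_nonneg (sub_nonneg.2 hqm.1)]; linarith [hqm.2]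
    · exact mul_nonneg hM0 (sub_nonneg.2 hst)
  have h5 : ⟪Y s, X q - X t⟫ ≤ M * (M * (t - s)) := by
    refine (real_inner_le_norm _ _).trans
      (mul_le_mul (hX.norm_vel_le s hsm) ?_ (norm_nonneg _) hM0)
    refine (hX.lip_pos q (hsub q hqm) t htm).trans (mul_le_mul_of_nonneg_left ?_ hM0)
    rw [abs_sub_comm, abs_of_nonneg (sub_nonneg.2 hqm.2)]; linarith [hqm.1]
  linarith

theorem IsLagrangianOn.error_step (hX : IsLagrangianOn K F X Y T M) {s h : ℝ} (hs : 0 ≤ s)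
    (hh : 0 < h) (hC : 10 * M ^ 2 * h ≤ 1 / 2) (ht : s + h ≤ T) {x y x' : E} (hx : x ∈ K)
    (hx' : x' ∈ K) (hn : ∀ z ∈ K, ⟪x + h • y - x', z - x'⟫ ≤ 0) :
    ‖x' - X (s + h)‖ ^ 2 + ‖y + h • F x' - Y (s + h)‖ ^ 2 ≤
      (1 + 4 * (10 * M ^ 2) * h) * (‖x - X s‖ ^ 2 + ‖y - Y s‖ ^ 2)
        + 2 * (10 * M ^ 2) * h ^ 2 := by
  have hM0 : 0 ≤ M := zero_le_one.trans hX.one_le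
  have hst : s ≤ s + h := by linarith
  have hsm : s ∈ Icc 0 T := ⟨hs, hst.trans ht⟩
  have htm : s + h ∈ Icc 0 T := ⟨hs.trans hst, ht⟩
  have e : s + h - s = h := by ring
  refine real_error_step hX.one_le hh hC (norm_nonneg _) (norm_nonneg _) (norm_nonneg _)
    (norm_nonneg _) ?_ ?_
  · have h1 := hX.norm_sq_sub_le hs hst ht hx
    rw [e, norm_sub_rev (X s) x] at h1
    have h2 := hn _ (hX.mem _ htm)
    have hxx : ‖x' - x‖ ≤ h * (M + ‖y - Y s‖) := by
      have i1 := hn x hx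
      have i2 : ‖x' - x‖ ^ 2 ≤ h * (‖y‖ * ‖x' - x‖) := by
        have j1 : ⟪x + h • y - x', x - x'⟫ = ‖x' - x‖ ^ 2 - h * ⟪y, x' - x⟫ := by
          rw [← real_inner_self_eq_norm_sq, ← real_inner_smul_left, ← inner_sub_left,
            ← inner_neg_neg]
          congr 1 <;> abel
        have j2 := mul_le_mul_of_nonneg_left (real_inner_le_norm y (x' - x)) hh.le
        linarith
      have i3 : ‖y‖ ≤ M + ‖y - Y s‖ := by
        have := norm_le_norm_add_norm_sub (Y s) y
        rw [norm_sub_rev] at this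
        linarith [hX.norm_vel_le s hsm]
      have i4 : ‖x' - x‖ ≤ h * ‖y‖ := by
        rcases (norm_nonneg (x' - x)).eq_or_lt with h0 | h0
        · rw [← h0]; positivity
        · nlinarith
      exact i4.trans (mul_le_mul_of_nonneg_left i3 hh.le)
    have h3 : ‖x' - X (s + h)‖ ^ 2 ≤ ‖X (s + h) - x‖ ^ 2 + 2 * h * ⟪y, x' - X (s + h)⟫ := by
      have j1 : ⟪x + h • y - x', X (s + h) - x'⟫
          = ⟪x' - x, x' - X (s + h)⟫ - h * ⟪y, x' - X (s + h)⟫ := by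
        rw [← real_inner_smul_left, ← inner_sub_left, ← inner_neg_neg]
        congr 1 <;> abel
      have j2 : X (s + h) - x = (x' - x) - (x' - X (s + h)) := by abel
      have j3 := norm_sub_sq_real (x' - x) (x' - X (s + h))
      rw [j2, j3]
      nlinarith [sq_nonneg ‖x' - x‖]
    have h4 : ⟪Y s, X (s + h) - x⟫ + ⟪y, x' - X (s + h)⟫
        = ⟪y - Y s, x' - X (s + h)⟫ + ⟪Y s, x' - x⟫ := by
      simp only [inner_sub_left, inner_sub_right]; ring
    have h5 := real_inner_le_norm (y - Y s) (x' - X (s + h))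
    have h6 : ⟪Y s, x' - x⟫ ≤ M * (h * (M + ‖y - Y s‖)) :=
      (real_inner_le_norm _ _).trans (mul_le_mul (hX.norm_vel_le s hsm) hxx (norm_nonneg _) hM0)
    have hh1 : h ≤ 1 := by nlinarith [hX.one_le]
    have h7 : M * h * (M * h) ≤ M * h * M := by
      refine mul_le_mul_of_nonneg_left ?_ (by positivity)
      nlinarith
    have h8 := mul_le_mul_of_nonneg_left (add_le_add h5 h6) (by positivity : 0 ≤ 2 * h)
    have h9 := mul_le_mul_of_nonneg_left h7 (by positivity : 0 ≤ 2 * h)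
    nlinarith
  · have h1 := hX.vel_sub_le s (s + h) hs hst ht x' hx' (M * (M * h + ‖x' - X (s + h)‖)) ?_
    · rw [e] at h1
      have h2 : y + h • F x' - Y (s + h) = (y - Y s) - (Y (s + h) - Y s - h • F x') := by abel
      rw [h2]
      refine (norm_sub_le _ _).trans ?_
      linarith
    · intro q hq
      have hqm : q ∈ Icc 0 T := ⟨hs.trans hq.1, hq.2.trans ht⟩
      refine (hX.lip_force _ (hX.mem q hqm) _ hx').trans (mul_le_mul_of_nonneg_left ?_ hM0)
      have h2 := norm_sub_le_norm_sub_add_norm_sub (X q) (X (s + h)) x'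
      have h3 := hX.lip_pos q hqm _ htm
      rw [abs_sub_comm, abs_of_nonneg (sub_nonneg.2 hq.2)] at h3
      have h4 : M * (s + h - q) ≤ M * h := mul_le_mul_of_nonneg_left (by linarith [hq.1]) hM0
      rw [norm_sub_rev (X (s + h)) x'] at h2
      linarith

theorem IsLagrangianOn.isAdmissible_of_hasDerivAt (hX : IsLagrangianOn K F X Y T M)
    (hK : IsStickyFamily K H) {t : ℝ} (ht : t ∈ Ioo 0 T) {V : E} (hV : HasDerivAt X V t)
    (hN : ∀ z ∈ K, ⟪Y t - V, z - X t⟫ ≤ 0) : IsAdmissible K H (X t) (Y t) := by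
  intro z hz
  have hXt := hX.mem t (Ioo_subset_Icc_self ht)
  have h1 := hK.normal_sub_le hXt hN hz
  have h2 : HasDerivAt (fun q => ⟪X q, z - (H (X t)).starProjection z⟫)
      ⟪V, z - (H (X t)).starProjection z⟫ t := by
    simpa using hV.inner ℝ (hasDerivAt_const t (z - (H (X t)).starProjection z))
  have h3 : IsLocalMin (fun q => ⟪X q, z - (H (X t)).starProjection z⟫) t := by
    filter_upwards [isOpen_Ioo.mem_nhds ht] with q hq
    rw [sub_starProjection_inner_eq_zero (H (X t)) z (hK.mem_self _ hXt)]
    exact hK.inner_nonneg _ hXt z hz _ (hX.mem q (Ioo_subset_Icc_self hq))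
  have h4 := h3.hasDerivAt_eq_zero h2
  rw [inner_sub_left] at h1
  linarith

variable [CompleteSpace E]

theorem IsStickyFamily.exists_proj (hK : IsStickyFamily K H) (u : E) :
    ∃ x ∈ K, ∀ z ∈ K, ⟪u - x, z - x⟫ ≤ 0 := by
  obtain ⟨x, hx, h⟩ :=
    exists_norm_eq_iInf_of_complete_convex hK.nonempty hK.closed.isComplete hK.convex u
  exact ⟨x, hx, (norm_eq_iInf_iff_real_inner_le_zero hK.convex hx).1 h⟩

theorem IsLagrangianOn.exists_approx (hX : IsLagrangianOn K F X Y T M)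
    (hK : IsStickyFamily K H) (hF : ∀ x ∈ K, IsAdmissible K H x (F x)) {s h : ℝ} (hs : 0 ≤ s)
    (hh : 0 < h) (hC : 10 * M ^ 2 * h ≤ 1 / 2) (hadm : IsAdmissible K H (X s) (Y s)) (n : ℕ)
    (hn : s + n * h ≤ T) :
    ∃ x y : E, x ∈ K ∧ x ∈ H (X s) ∧ IsAdmissible K H x y ∧
      ‖x - X (s + n * h)‖ ^ 2 + ‖y - Y (s + n * h)‖ ^ 2 + h / 2
        ≤ (1 + 4 * (10 * M ^ 2) * h) ^ n * (h / 2) := by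
  induction n with
  | zero =>
    have hXs := hX.mem s ⟨hs, by simpa using hn⟩
    exact ⟨X s, Y s, hXs, hK.mem_self _ hXs, hadm, by simp⟩
  | succ n ih =>
    have hc : s + (n + 1 : ℕ) * h = s + n * h + h := by push_cast; ring
    rw [hc] at hn ⊢
    have hnh : 0 ≤ n * h := by positivity
    obtain ⟨x, y, hx, hxH, hxy, herr⟩ := ih (by linarith)
    obtain ⟨x', hx', hN⟩ := hK.exists_proj (x + h • y)
    have hXs := hX.mem s ⟨hs, by linarith⟩
    have hx'H := hK.mem_of_isAdmissible hh.le hx hx' hxy hN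
    have hadm' := hK.isAdmissible_of_isAdmissible hh hx hx' hN
    refine ⟨x', y + h • F x', hx', hK.mono _ hXs x hx hxH hx'H, fun z hz => ?_, ?_⟩
    · rw [inner_add_left, real_inner_smul_left]
      have := mul_nonpos_of_nonneg_of_nonpos hh.le (hF x' hx' z hz)
      linarith [hadm' z hz]
    · have h1 := hX.error_step (by linarith : 0 ≤ s + n * h) hh hC hn hx hx' hN
      have h2 := mul_le_mul_of_nonneg_left herr
        (by positivity : 0 ≤ 1 + 4 * (10 * M ^ 2) * h)
      rw [pow_succ (1 + 4 * (10 * M ^ 2) * h)]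
      linarith

theorem IsLagrangianOn.mem_of_isAdmissible (hX : IsLagrangianOn K F X Y T M)
    (hK : IsStickyFamily K H) (hF : ∀ x ∈ K, IsAdmissible K H x (F x)) {s t : ℝ} (hs : 0 ≤ s)
    (hst : s ≤ t) (ht : t ≤ T) (hadm : IsAdmissible K H (X s) (Y s)) : X t ∈ H (X s) := by
  rcases hst.eq_or_lt with rfl | hst
  · exact hK.mem_self _ (hX.mem _ ⟨hs, ht⟩)
  have hcl : IsClosed (H (X s) : Set E) := by
    rw [← (H (X s)).orthogonal_orthogonal]
    exact (H (X s))ᗮ.isClosed_orthogonal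
  have hlim : Tendsto (fun n : ℕ => (t - s) / n) atTop (nhds 0) :=
    tendsto_const_div_atTop_nhds_zero_nat _
  have hlim1 : Tendsto (fun n : ℕ => 10 * M ^ 2 * ((t - s) / n)) atTop (nhds 0) := by
    simpa using hlim.const_mul (10 * M ^ 2)
  have hlim2 : Tendsto (fun n : ℕ =>
      Real.exp (4 * (10 * M ^ 2) * (t - s)) * ((t - s) / n / 2)) atTop (nhds 0) := by
    simpa using (hlim.div_const 2).const_mul (Real.exp (4 * (10 * M ^ 2) * (t - s)))
  rw [← SetLike.mem_coe, ← hcl.closure_eq, Metric.mem_closure_iff]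
  intro ε hε
  obtain ⟨n, hn1, hn2, hn0⟩ := ((hlim1.eventually_le_const (by norm_num : (0 : ℝ) < 1 / 2)).and
    ((hlim2.eventually_lt_const (by positivity : 0 < ε ^ 2)).and (eventually_gt_atTop 0))).exists
  have hn0' : (0 : ℝ) < n := by exact_mod_cast hn0
  have hh : 0 < (t - s) / n := div_pos (sub_pos.2 hst) hn0'
  have hnh : n * ((t - s) / n) = t - s := by field_simp
  have hsn : s + n * ((t - s) / n) = t := by rw [hnh]; ring
  obtain ⟨x, y, -, hxH, -, herr⟩ := hX.exists_approx hK hF hs hh hn1 hadm n (by rw [hsn]; exact ht)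
  rw [hsn] at herr
  refine ⟨x, hxH, ?_⟩
  have h1 : (1 + 4 * (10 * M ^ 2) * ((t - s) / n)) ^ n
      ≤ Real.exp (4 * (10 * M ^ 2) * (t - s)) := by
    have i1 : 1 + 4 * (10 * M ^ 2) * ((t - s) / n)
        ≤ Real.exp (4 * (10 * M ^ 2) * ((t - s) / n)) := by
      rw [add_comm]; exact Real.add_one_le_exp _
    refine (pow_le_pow_left₀ (by positivity) i1 n).trans_eq ?_
    rw [← Real.exp_nat_mul]
    congr 1
    calc _ = 4 * (10 * M ^ 2) * (n * ((t - s) / n)) := by ring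
      _ = _ := by rw [hnh]
  have h2 := mul_le_mul_of_nonneg_right h1 (by positivity : 0 ≤ (t - s) / n / 2)
  rw [dist_comm, dist_eq_norm]
  refine lt_of_pow_lt_pow_left₀ 2 hε.le ?_
  nlinarith [sq_nonneg ‖y - Y t‖]

theorem IsLagrangianOn.isAdmissible (hX : IsLagrangianOn K F X Y T M)
    (hK : IsStickyFamily K H) (hF : ∀ x ∈ K, IsAdmissible K H x (F x)) {s : ℝ} (hs : 0 < s)
    (hsT : s ≤ T) : IsAdmissible K H (X s) (Y s) := by
  intro z hz
  have hM0 : 0 ≤ M := zero_le_one.trans hX.one_le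
  have hsm : s ∈ Icc 0 T := ⟨hs.le, hsT⟩
  have hXs := hX.mem s hsm
  set u := z - (H (X s)).starProjection z with hu
  have key : ∀ r ∈ Ioo 0 s, ⟪Y s, u⟫ ≤ M * (s - r) * ‖u‖ := by
    intro r hr
    have hsub : ∀ q ∈ Icc r s, q ∈ Icc 0 T := fun q hq => ⟨hr.1.le.trans hq.1, hq.2.trans hsT⟩
    have hlip : LipschitzOnWith (Real.toNNReal (M * ‖u‖)) (fun q => -⟪X q, u⟫) (Icc r s) := by
      refine LipschitzOnWith.of_dist_le_mul fun q hq q' hq' => ?_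
      rw [Real.coe_toNNReal _ (by positivity), Real.dist_eq, Real.dist_eq]
      have e : -⟪X q, u⟫ - -⟪X q', u⟫ = -⟪X q - X q', u⟫ := by rw [inner_sub_left]; ring
      rw [e, abs_neg]
      refine (abs_real_inner_le_norm _ _).trans ?_
      have := mul_le_mul_of_nonneg_right (hX.lip_pos q (hsub q hq) q' (hsub q' hq'))
        (norm_nonneg u)
      linarith
    have h1 := sub_le_mul_of_ae_hasDerivAt_le (B := M * (s - r) * ‖u‖ - ⟪Y s, u⟫) hr.2.le hlip ?_
    · have h2 : ⟪X s, u⟫ = 0 :=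
        sub_starProjection_inner_eq_zero (H (X s)) z (hK.mem_self _ hXs)
      have h3 : 0 ≤ ⟪X r, u⟫ :=
        hK.inner_nonneg _ hXs z hz _ (hX.mem r (hsub r ⟨le_rfl, hr.2.le⟩))
      have h4 : 0 < s - r := sub_pos.2 hr.2
      rw [h2] at h1
      by_contra! hc
      nlinarith
    · filter_upwards [hX.deriv] with q hq hqs
      have hqT : q ∈ Ioo 0 T := ⟨hr.1.trans hqs.1, hqs.2.trans_le hsT⟩
      have hXq := hX.mem q (Ioo_subset_Icc_self hqT)
      obtain ⟨V, hV, hN⟩ := hq hqT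
      have hadm := hX.isAdmissible_of_hasDerivAt hK hqT hV hN
      have hmem := hX.mem_of_isAdmissible hK hF hqT.1.le hqs.2.le hsT hadm
      refine ⟨-⟪V, u⟫, by simpa using (hV.inner ℝ (hasDerivAt_const q u)).fun_neg, ?_⟩
      have hzero : ⟪Y q - V, X s⟫ = 0 := by
        have := hK.normal_proj _ hXq _ hN _ hXs
        rwa [Submodule.starProjection_eq_self_iff.2 hmem] at this
      have hN' : ∀ w ∈ K, ⟪Y q - V, w - X s⟫ ≤ 0 := fun w hw => by
        rw [inner_sub_right, hzero, sub_zero]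
        exact hK.normal_le _ hXq _ hN w hw
      have h1 : ⟪Y q - V, u⟫ ≤ 0 := hK.normal_sub_le hXs hN' hz
      have h2 : ⟪Y s - Y q, u⟫ ≤ M * (s - r) * ‖u‖ := by
        refine (real_inner_le_norm _ _).trans (mul_le_mul_of_nonneg_right ?_ (norm_nonneg u))
        refine (hX.lip_vel s hsm q (Ioo_subset_Icc_self hqT)).trans
          (mul_le_mul_of_nonneg_left ?_ hM0)
        rw [abs_of_nonneg (sub_nonneg.2 hqs.2.le)]; linarith [hqs.1]
      rw [inner_sub_left] at h1 h2
      linarith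
  have hlim : Tendsto (fun r => M * (s - r) * ‖u‖) (nhdsWithin s (Iio s)) (nhds 0) := by
    have : Continuous fun r => M * (s - r) * ‖u‖ := by fun_prop
    simpa using (this.tendsto s).mono_left nhdsWithin_le_nhds
  refine ge_of_tendsto hlim ?_
  filter_upwards [Ioo_mem_nhdsLT hs] with r hr using key r hr

/-- Lagrangian solutions never leave the subspaces they enter. -/
theorem IsLagrangianOn.mem_of_le (hX : IsLagrangianOn K F X Y T M)
    (hK : IsStickyFamily K H) (hF : ∀ x ∈ K, IsAdmissible K H x (F x))
    (h0 : Y 0 ∈ H (X 0)) {s t : ℝ} (hs : 0 ≤ s) (hst : s ≤ t) (ht : t ≤ T) :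
    X t ∈ H (X s) := by
  refine hX.mem_of_isAdmissible hK hF hs hst ht ?_
  rcases hs.eq_or_lt with rfl | hs
  · exact fun z _ => (sub_starProjection_inner_eq_zero _ z h0).le
  · exact hX.isAdmissible hK hF hs (hst.trans ht)

end Abstract

instance isFiniteMeasure_mu : IsFiniteMeasure mu := by
  unfold mu Omg; infer_instance

instance nullSingletonClass_mu : NullSingletonClass mu := by
  unfold mu; infer_instance

theorem ae_mem_Omg : ∀ᵐ x ∂mu, x ∈ Omg := ae_restrict_mem measurableSet_Ioo

theorem L2_inner_eq (f g : L2) : ⟪f, g⟫ = ∫ x, f x * g x ∂mu := by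
  rw [MeasureTheory.L2.inner_def]
  simp [mul_comm]

/-- The indicator of `(p, 1)` as an element of `L²(Ω)`. -/
def stepFn (p : ℝ) : L2 :=
  indicatorConstLp 2 (measurableSet_Ioi : MeasurableSet (Ioi p)) (measure_ne_top mu _) (1 : ℝ)

theorem stepFn_coe (p : ℝ) : ⇑(stepFn p) =ᵐ[mu] (Ioi p).indicator fun _ => (1 : ℝ) :=
  indicatorConstLp_coeFn

theorem inner_stepFn (W : L2) (p : ℝ) : ⟪W, stepFn p⟫ = ∫ x in Ioi p, W x ∂mu := by
  rw [real_inner_comm]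
  exact L2.inner_indicatorConstLp_one measurableSet_Ioi (measure_ne_top mu _) W

theorem integrable_L2 (W : L2) : Integrable W mu :=
  (Lp.memLp W).integrable (by norm_num)

theorem intervalIntegrable_L2 (W : L2) {a b : ℝ} (ha : 0 ≤ a) (hab : a ≤ b) (hb : b ≤ 1) :
    IntervalIntegrable W volume a b := by
  rw [intervalIntegrable_iff_integrableOn_Ioo_of_le hab]
  exact IntegrableOn.mono_set (integrable_L2 W) (Ioo_subset_Ioo ha hb)

theorem inner_stepFn_sub (W : L2) {a b : ℝ} (ha : 0 ≤ a) (hab : a ≤ b) (hb : b ≤ 1) :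
    ⟪W, stepFn a⟫ - ⟪W, stepFn b⟫ = ∫ x in a..b, W x := by
  have h1 : Ioi a = Ioc a b ∪ Ioi b := (Ioc_union_Ioi_eq_Ioi hab).symm
  rw [inner_stepFn, inner_stepFn, h1, setIntegral_union (Ioc_disjoint_Ioi le_rfl)
    measurableSet_Ioi (integrable_L2 W).integrableOn (integrable_L2 W).integrableOn,
    add_sub_cancel_right, integral_Ioc_eq_integral_Ioo, intervalIntegral.integral_of_le hab,
    integral_Ioc_eq_integral_Ioo]
  have h2 : mu.restrict (Ioo a b) = volume.restrict (Ioo a b) := by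
    unfold mu Omg
    rw [Measure.restrict_restrict measurableSet_Ioo, inter_eq_left.2 (Ioo_subset_Ioo ha hb)]
  rw [h2]

theorem stepFn_one : stepFn 1 = 0 := by
  rw [Lp.eq_zero_iff_ae_eq_zero]
  filter_upwards [stepFn_coe 1, ae_mem_Omg] with x hx hxO
  rw [hx]
  exact indicator_of_notMem (by simpa using hxO.2.le) _

theorem stepFn_zero_coe : ⇑(stepFn 0) =ᵐ[mu] fun _ => (1 : ℝ) := by
  filter_upwards [stepFn_coe 0, ae_mem_Omg] with x hx hxO
  rw [hx]
  exact indicator_of_mem (by simpa using hxO.1) _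

theorem stepFn_mem_Kcone (p : ℝ) : stepFn p ∈ Kcone := by
  refine ⟨_, ?_, stepFn_coe p⟩
  intro x _ y _ hxy
  simp only [indicator, mem_Ioi]
  split_ifs <;> linarith

theorem neg_stepFn_zero_mem_Kcone : -stepFn 0 ∈ Kcone := by
  refine ⟨fun _ => -1, monotoneOn_const, ?_⟩
  filter_upwards [Lp.coeFn_neg (stepFn 0), stepFn_zero_coe] with x h1 h2
  rw [h1, Pi.neg_apply, h2]

theorem zero_mem_Kcone : (0 : L2) ∈ Kcone :=
  ⟨fun _ => 0, monotoneOn_const, Lp.coeFn_zero ℝ 2 mu⟩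

theorem add_mem_Kcone {X Z : L2} (hX : X ∈ Kcone) (hZ : Z ∈ Kcone) : X + Z ∈ Kcone := by
  obtain ⟨g, hg, hXg⟩ := hX
  obtain ⟨k, hk, hZk⟩ := hZ
  refine ⟨g + k, hg.add hk, ?_⟩
  filter_upwards [Lp.coeFn_add X Z, hXg, hZk] with x h1 h2 h3
  rw [h1, Pi.add_apply, Pi.add_apply, h2, h3]

theorem smul_mem_Kcone {X : L2} (hX : X ∈ Kcone) {c : ℝ} (hc : 0 ≤ c) : c • X ∈ Kcone := by
  obtain ⟨g, hg, hXg⟩ := hX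
  refine ⟨fun x => c * g x, fun x hx y hy hxy => mul_le_mul_of_nonneg_left (hg hx hy hxy) hc, ?_⟩
  filter_upwards [Lp.coeFn_smul c X, hXg] with x h1 h2
  rw [h1, Pi.smul_apply, h2, smul_eq_mul]

theorem convex_Kcone : Convex ℝ Kcone := fun _ hX _ hY _ _ ha hb _ =>
  add_mem_Kcone (smul_mem_Kcone hX ha) (smul_mem_Kcone hY hb)

theorem exists_mem_Ioo_of_ae {P : ℝ → Prop} (hP : ∀ᵐ x ∂mu, P x) {a b : ℝ} (ha : 0 ≤ a)
    (hab : a < b) (hb : b ≤ 1) : ∃ x ∈ Ioo a b, P x := by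
  have h1 : ∀ᵐ x ∂(volume.restrict (Ioo a b)), P x :=
    ae_restrict_of_ae_restrict_of_subset (Ioo_subset_Ioo ha hb) hP
  have h2 : (ae (volume.restrict (Ioo a b))).NeBot := by
    rw [ae_neBot, Ne, Measure.restrict_eq_zero, Real.volume_Ioo]
    simpa using hab
  obtain ⟨x, hx1, hx2⟩ := (h1.and (ae_restrict_mem measurableSet_Ioo)).exists
  exact ⟨x, hx2, hx1⟩

theorem exists_seq_tendsto_ae_L2 {Z : ℕ → L2} {W : L2} (h : Tendsto Z atTop (nhds W)) :
    ∃ ns : ℕ → ℕ, ∀ᵐ x ∂mu, Tendsto (fun i => Z (ns i) x) atTop (nhds (W x)) := by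
  obtain ⟨ns, -, hns⟩ := (tendstoInMeasure_of_tendsto_Lp h).exists_seq_tendsto_ae
  exact ⟨ns, hns⟩

theorem isClosed_Kcone : IsClosed Kcone := by
  refine IsSeqClosed.isClosed fun Z W hZ hlim => ?_
  obtain ⟨ns, hns⟩ := exists_seq_tendsto_ae_L2 hlim
  choose g hg hZg using hZ
  have hall : ∀ᵐ x ∂mu, ∀ n, Z n x = g n x := ae_all_iff.2 hZg
  set S : Set ℝ := {x | x ∈ Omg ∧ Tendsto (fun i => g (ns i) x) atTop (nhds (W x))} with hS
  have hSae : ∀ᵐ x ∂mu, x ∈ S := by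
    filter_upwards [hns, hall, ae_mem_Omg] with x h1 h2 h3
    exact ⟨h3, by simpa only [h2] using h1⟩
  have hmono : MonotoneOn W S := fun x hx y hy hxy =>
    le_of_tendsto_of_tendsto' hx.2 hy.2 fun i => hg (ns i) hx.1 hy.1 hxy
  have hbdd : ∀ m ∈ Omg, BddAbove (W '' (S ∩ Iic m)) := by
    intro m hm
    obtain ⟨y, hy, hyS⟩ := exists_mem_Ioo_of_ae hSae hm.1.le hm.2 le_rfl
    refine ⟨W y, ?_⟩
    rintro _ ⟨x, ⟨hxS, hxm⟩, rfl⟩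
    exact hmono hxS hyS (hxm.trans hy.1.le)
  refine ⟨fun m => sSup (W '' (S ∩ Iic m)), fun x hx y hy hxy => ?_, ?_⟩
  · obtain ⟨z, hz, hzS⟩ := exists_mem_Ioo_of_ae hSae le_rfl hx.1 hx.2.le
    exact csSup_le_csSup (hbdd y hy) ⟨W z, z, ⟨hzS, hz.2.le⟩, rfl⟩
      (image_mono (inter_subset_inter_right _ (Iic_subset_Iic.2 hxy)))
  · filter_upwards [hSae] with x hx
    refine le_antisymm (le_csSup (hbdd x hx.1) ⟨x, ⟨hx, self_mem_Iic⟩, rfl⟩)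
      (csSup_le ⟨W x, x, ⟨hx, self_mem_Iic⟩, rfl⟩ ?_)
    rintro _ ⟨y, ⟨hyS, hyx⟩, rfl⟩
    exact hmono hyS hx hyx

theorem tendsto_inner_of_dominated (W : L2) {Φ : ℕ → L2} {Z G : L2}
    (hb : ∀ n, ∀ᵐ x ∂mu, |Φ n x| ≤ G x)
    (hlim : ∀ᵐ x ∂mu, Tendsto (fun n => Φ n x) atTop (nhds (Z x))) :
    Tendsto (fun n => ⟪W, Φ n⟫) atTop (nhds ⟪W, Z⟫) := by
  simp only [L2_inner_eq]
  refine tendsto_integral_of_dominated_convergence (fun x => |W x| * G x) (fun n => ?_) ?_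
    (fun n => ?_) ?_
  · exact (Lp.aestronglyMeasurable W).mul (Lp.aestronglyMeasurable (Φ n))
  · exact (Lp.memLp W).abs.integrable_mul (Lp.memLp G)
  · filter_upwards [hb n] with x hx
    rw [Real.norm_eq_abs, abs_mul]
    exact mul_le_mul_of_nonneg_left hx (abs_nonneg _)
  · filter_upwards [hlim] with x hx
    exact hx.const_mul _

theorem MonotoneOn.exists_superlevel {g : ℝ → ℝ} (hg : MonotoneOn g Omg) (d : ℝ) :
    ∃ p ∈ Icc (0 : ℝ) 1, ∀ x ∈ Omg, x ≠ p → (d ≤ g x ↔ p < x) := by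
  set A : Set ℝ := insert 1 {x | x ∈ Omg ∧ d ≤ g x} with hA
  have hA0 : ∀ x ∈ A, 0 ≤ x := by
    rintro x (rfl | hx)
    · exact zero_le_one
    · exact hx.1.1.le
  have hbdd : BddBelow A := ⟨0, hA0⟩
  have hne : A.Nonempty := ⟨1, mem_insert _ _⟩
  refine ⟨sInf A, ⟨le_csInf hne hA0, csInf_le hbdd (mem_insert _ _)⟩, fun x hx hxp => ?_⟩
  constructor
  · intro h
    exact lt_of_le_of_ne (csInf_le hbdd (mem_insert_of_mem _ ⟨hx, h⟩)) hxp.symm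
  · intro h
    obtain ⟨y, hy, hyx⟩ := exists_lt_of_csInf_lt hne h
    rcases hy with rfl | hy
    · exact absurd hx.2 hyx.not_gt
    · exact hy.2.trans (hg hy.1 hx hyx.le)

theorem sum_range_ite_eq_min_floor (m : ℕ) (y : ℝ) :
    (∑ j ∈ Finset.range m, if ((j : ℝ) + 1 ≤ y) then (1 : ℝ) else 0)
      = (min ⌊y⌋₊ m : ℕ) := by
  rw [Finset.sum_boole]
  congr 1
  have : (Finset.range m).filter (fun j : ℕ => (j : ℝ) + 1 ≤ y) = Finset.range (min ⌊y⌋₊ m) := by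
    ext j
    have h := Nat.le_floor_iff' (a := y) (Nat.succ_ne_zero j)
    push_cast at h
    simp only [Finset.mem_filter, Finset.mem_range, lt_min_iff, ← h]
    omega
  rw [this, Finset.card_range]

/-- The truncation of `g` to `[-N, N]`, rounded down to a multiple of `1 / N`. -/
def roundDown (N : ℕ) (g : ℝ) : ℝ :=
  ((min ⌊(N : ℝ) * g + (N : ℝ) ^ 2⌋₊ (2 * N ^ 2) : ℕ) - (N : ℝ) ^ 2) / N

theorem abs_roundDown_sub_le {N : ℕ} (hN : 0 < N) {g : ℝ} (hg : |g| ≤ N) :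
    |roundDown N g - g| ≤ 1 / N := by
  have hN0 : (0 : ℝ) < N := by exact_mod_cast hN
  obtain ⟨h1, h2⟩ := abs_le.1 hg
  have hy0 : 0 ≤ (N : ℝ) * g + (N : ℝ) ^ 2 := by nlinarith
  have hy1 : (N : ℝ) * g + (N : ℝ) ^ 2 ≤ (2 * N ^ 2 : ℕ) := by push_cast; nlinarith
  have hmin : min ⌊(N : ℝ) * g + (N : ℝ) ^ 2⌋₊ (2 * N ^ 2) = ⌊(N : ℝ) * g + (N : ℝ) ^ 2⌋₊ :=
    min_eq_left (Nat.floor_le_of_le hy1)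
  have h3 := Nat.floor_le hy0
  have h4 := Nat.lt_floor_add_one ((N : ℝ) * g + (N : ℝ) ^ 2)
  have e : roundDown N g - g
      = ((⌊(N : ℝ) * g + (N : ℝ) ^ 2⌋₊ : ℝ) - ((N : ℝ) * g + (N : ℝ) ^ 2)) / N := by
    rw [roundDown, hmin]; field_simp; ring
  rw [e, abs_div, abs_of_pos hN0]
  gcongr
  rw [abs_le]; constructor <;> linarith

theorem abs_roundDown_le {N : ℕ} (hN : 0 < N) (g : ℝ) : |roundDown N g| ≤ |g| + 1 := by
  have hN0 : (0 : ℝ) < N := by exact_mod_cast hN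
  have hN1 : (1 : ℝ) ≤ N := by exact_mod_cast hN
  rcases le_or_gt |g| N with hg | hg
  · have h1 := abs_roundDown_sub_le hN hg
    have h2 : 1 / (N : ℝ) ≤ 1 := by rw [div_le_one hN0]; exact hN1
    have h3 := abs_sub_abs_le_abs_sub (roundDown N g) g
    linarith
  · have h1 : |roundDown N g| ≤ N := by
      rw [roundDown, abs_div, abs_of_pos hN0, div_le_iff₀ hN0, abs_le]
      have h2 : ((min ⌊(N : ℝ) * g + (N : ℝ) ^ 2⌋₊ (2 * N ^ 2) : ℕ) : ℝ) ≤ (2 * N ^ 2 : ℕ) :=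
        Nat.cast_le.2 (min_le_right _ _)
      have h3 : (0 : ℝ) ≤ ((min ⌊(N : ℝ) * g + (N : ℝ) ^ 2⌋₊ (2 * N ^ 2) : ℕ) : ℝ) :=
        Nat.cast_nonneg _
      push_cast at h2 h3 ⊢
      constructor <;> nlinarith
    linarith

theorem tendsto_roundDown (g : ℝ) :
    Tendsto (fun n : ℕ => roundDown (n + 1) g) atTop (nhds g) := by
  rw [tendsto_iff_norm_sub_tendsto_zero]
  refine squeeze_zero' (Eventually.of_forall fun _ => norm_nonneg _) ?_
    tendsto_one_div_add_atTop_nhds_zero_nat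
  filter_upwards [eventually_ge_atTop ⌈|g|⌉₊] with n hn
  have h := abs_roundDown_sub_le (N := n + 1) n.succ_pos (g := g) (by
    push_cast
    linarith [Nat.ceil_le.1 hn])
  simpa using h

theorem exists_stepFn_combination {g : ℝ → ℝ} (hg : MonotoneOn g Omg) {N : ℕ} (hN : 0 < N) :
    ∃ p : ℕ → ℝ, (∀ j, p j ∈ Icc (0 : ℝ) 1) ∧
      ⇑((1 / (N : ℝ)) • (∑ j ∈ Finset.range (2 * N ^ 2), stepFn (p j) - (N : ℝ) ^ 2 • stepFn 0))
        =ᵐ[mu] fun x => roundDown N (g x) := by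
  have hN0 : (0 : ℝ) < N := by exact_mod_cast hN
  choose p hp hpx using fun j : ℕ => hg.exists_superlevel (((j : ℝ) + 1 - (N : ℝ) ^ 2) / N)
  refine ⟨p, hp, ?_⟩
  have hne : ∀ᵐ x ∂mu, ∀ j, x ≠ p j := by
    refine ae_all_iff.2 fun j => ?_
    have : ∀ᵐ x : ℝ ∂volume, x ≠ p j := by simp [ae_iff]
    exact ae_restrict_of_ae this
  have hst : ∀ᵐ x ∂mu, ∀ j, stepFn (p j) x = (Ioi (p j)).indicator (fun _ => (1 : ℝ)) x :=
    ae_all_iff.2 fun j => stepFn_coe (p j)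
  have hsum : ⇑(∑ j ∈ Finset.range (2 * N ^ 2), stepFn (p j))
      =ᵐ[mu] fun x => ∑ j ∈ Finset.range (2 * N ^ 2), stepFn (p j) x := by
    filter_upwards [Lp.coeFn_finsetSum (Finset.range (2 * N ^ 2)) fun j => stepFn (p j)] with x hx
    rw [hx, Finset.sum_apply]
  filter_upwards [hne, hst, hsum, ae_mem_Omg, stepFn_zero_coe,
    Lp.coeFn_smul (1 / (N : ℝ))
      (∑ j ∈ Finset.range (2 * N ^ 2), stepFn (p j) - (N : ℝ) ^ 2 • stepFn 0),
    Lp.coeFn_sub (∑ j ∈ Finset.range (2 * N ^ 2), stepFn (p j)) ((N : ℝ) ^ 2 • stepFn 0),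
    Lp.coeFn_smul ((N : ℝ) ^ 2) (stepFn 0)] with x h1 h2 h3 h4 h5 h6 h7 h8
  rw [h6, Pi.smul_apply, h7, Pi.sub_apply, h3, h8, Pi.smul_apply, h5, roundDown,
    ← sum_range_ite_eq_min_floor, smul_eq_mul, smul_eq_mul, mul_one, one_div, inv_mul_eq_div]
  congr 2
  refine Finset.sum_congr rfl fun j _ => ?_
  rw [h2]
  have e : p j < x ↔ (j : ℝ) + 1 ≤ (N : ℝ) * g x + (N : ℝ) ^ 2 := by
    rw [← hpx j x h4 (h1 j), div_le_iff₀ hN0]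
    constructor <;> intro h <;> linarith
  simp only [indicator, mem_Ioi, e]

/-- The steps generate the cone of monotone functions. -/
theorem inner_nonpos_of_stepFn {W : L2} (h0 : ⟪W, stepFn 0⟫ = 0)
    (hp : ∀ p ∈ Icc (0 : ℝ) 1, ⟪W, stepFn p⟫ ≤ 0) {Z : L2} (hZ : Z ∈ Kcone) : ⟪W, Z⟫ ≤ 0 := by
  obtain ⟨g, hg, hZg⟩ := hZ
  choose p hpm hpx using fun n : ℕ => exists_stepFn_combination hg n.succ_pos
  have hG : MemLp (fun x => |Z x| + 1) 2 mu := (Lp.memLp Z).abs.add (memLp_const 1)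
  refine le_of_tendsto' (tendsto_inner_of_dominated W (G := hG.toLp)
    (Φ := fun n => (1 / ((n + 1 : ℕ) : ℝ)) • (∑ j ∈ Finset.range (2 * (n + 1) ^ 2),
      stepFn (p n j) - ((n + 1 : ℕ) : ℝ) ^ 2 • stepFn 0)) (fun n => ?_) ?_) fun n => ?_
  · filter_upwards [hpx n, hZg, hG.coeFn_toLp] with x h1 h2 h3
    rw [h1, h3, h2]
    exact abs_roundDown_le n.succ_pos _
  · have hall := ae_all_iff.2 hpx
    filter_upwards [hall, hZg] with x h1 h2
    rw [h2]
    exact (tendsto_roundDown (g x)).congr fun n => (h1 n).symm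
  · rw [real_inner_smul_right, inner_sub_right, inner_sum, real_inner_smul_right, h0, mul_zero,
      sub_zero]
    exact mul_nonpos_of_nonneg_of_nonpos (by positivity)
      (Finset.sum_nonpos fun j _ => hp _ (hpm n j))

theorem isOpen_OmegaX (X : L2) : IsOpen (OmegaX X) := by
  rw [isOpen_iff_mem_nhds]
  rintro m ⟨hm, U, hU, c, hc⟩
  obtain ⟨V, hVU, hVo, hmV⟩ := mem_nhds_iff.1 hU
  filter_upwards [isOpen_Ioo.mem_nhds hm, hVo.mem_nhds hmV] with y hy hyV
  exact ⟨hy, V, hVo.mem_nhds hyV, c, ae_restrict_of_ae_restrict_of_subset hVU hc⟩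

theorem exists_Ioo_of_mem_OmegaX {X : L2} {g : ℝ → ℝ} (hg : MonotoneOn g Omg)
    (hXg : ⇑X =ᵐ[mu] g) {m : ℝ} (hm : m ∈ OmegaX X) :
    ∃ a b, m ∈ Ioo a b ∧ ∀ x ∈ Ioo a b, g x = g m := by
  obtain ⟨hmO, U, hU, c, hc⟩ := hm
  obtain ⟨a, b, hmab, hab⟩ := mem_nhds_iff_exists_Ioo_subset.1
    (inter_mem hU (isOpen_Ioo.mem_nhds hmO))
  have hlt : a < b := hmab.1.trans hmab.2
  have habO : Ioo a b ⊆ Ioo 0 1 := fun x hx => (hab hx).2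
  obtain ⟨ha, hb⟩ := (Ioo_subset_Ioo_iff hlt).1 habO
  have hae : ∀ᵐ x ∂mu, x ∈ Ioo a b → g x = c := by
    have h1 : ∀ᵐ x ∂mu, x ∈ Ioo a b → X x = c := (ae_restrict_iff' measurableSet_Ioo).1
      (ae_restrict_of_ae_restrict_of_subset (fun x hx => (hab hx).1) hc)
    filter_upwards [h1, hXg] with x h1 h2 hx
    rw [← h2, h1 hx]
  have key : ∀ x ∈ Ioo a b, g x = c := by
    intro x hx
    obtain ⟨y, hy, hyc⟩ := exists_mem_Ioo_of_ae hae ha hx.1 (hx.2.le.trans hb)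
    obtain ⟨z, hz, hzc⟩ := exists_mem_Ioo_of_ae hae (ha.trans hx.1.le) hx.2 hb
    have hy' : y ∈ Ioo a b := ⟨hy.1, hy.2.trans hx.2⟩
    have hz' : z ∈ Ioo a b := ⟨hx.1.trans hz.1, hz.2⟩
    have h1 := hg (habO hy') (habO hx) hy.2.le
    have h2 := hg (habO hx) (habO hz') hz.1.le
    rw [hyc hy'] at h1
    rw [hzc hz'] at h2
    exact le_antisymm h2 h1
  exact ⟨a, b, hmab, fun x hx => by rw [key x hx, key m hmab]⟩

theorem mem_OmegaX_of_mem_nhds {X : L2} {g : ℝ → ℝ} (hXg : ⇑X =ᵐ[mu] g) {m c : ℝ}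
    (hm : m ∈ Omg) {U : Set ℝ} (hU : U ∈ nhds m) (h : ∀ x ∈ U, g x = c) : m ∈ OmegaX X := by
  obtain ⟨V, hVU, hVo, hmV⟩ := mem_nhds_iff.1 hU
  refine ⟨hm, V, hVo.mem_nhds hmV, c, ?_⟩
  rw [ae_restrict_iff' hVo.measurableSet]
  filter_upwards [hXg] with x hx hxV
  rw [hx, h x (hVU hxV)]

theorem eqOn_connectedComponentIn_OmegaX {X : L2} {g : ℝ → ℝ} (hg : MonotoneOn g Omg)
    (hXg : ⇑X =ᵐ[mu] g) {m : ℝ} (hm : m ∈ OmegaX X) :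
    ∀ x ∈ connectedComponentIn (OmegaX X) m, g x = g m := by
  intro x hx
  refine (isPreconnected_connectedComponentIn.induction₂ (fun y z => g z = g y) ?_ ?_ ?_
    (mem_connectedComponentIn hm) hx)
  · intro y hy
    obtain ⟨a, b, hyab, h⟩ :=
      exists_Ioo_of_mem_OmegaX hg hXg (connectedComponentIn_subset _ _ hy)
    filter_upwards [mem_nhdsWithin_of_mem_nhds (isOpen_Ioo.mem_nhds hyab)] with z hz
    exact h z hz
  · intro u v w _ _ _ h1 h2
    exact h2.trans h1
  · intro u v _ _ h
    exact h.symm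

theorem mem_HX_self {X : L2} (hX : X ∈ Kcone) : X ∈ HX X := by
  obtain ⟨g, hg, hXg⟩ := hX
  exact ⟨g, hXg, fun m hm => eqOn_connectedComponentIn_OmegaX hg hXg hm⟩

theorem OmegaX_subset_of_mem_HX {X X' : L2} (h : X' ∈ HX X) : OmegaX X ⊆ OmegaX X' := by
  obtain ⟨g, hg, hgc⟩ := h
  intro m hm
  exact mem_OmegaX_of_mem_nhds hg hm.1
    ((isOpen_OmegaX X).connectedComponentIn.mem_nhds (mem_connectedComponentIn hm)) (hgc m hm)

theorem HX_subset_of_OmegaX_subset {X X' : L2} (h : OmegaX X ⊆ OmegaX X') : HX X' ⊆ HX X := by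
  rintro U ⟨g, hg, hgc⟩
  exact ⟨g, hg, fun m hm x hx => hgc m (h hm) x (connectedComponentIn_mono m h hx)⟩

/-- `HX X` as a subspace of `L²(Ω)`. -/
def HXsub (X : L2) : Submodule ℝ L2 where
  carrier := HX X
  zero_mem' := ⟨fun _ => 0, Lp.coeFn_zero ℝ 2 mu, fun _ _ _ _ => rfl⟩
  add_mem' := by
    rintro U V ⟨g, hg, hgc⟩ ⟨k, hk, hkc⟩
    refine ⟨g + k, (Lp.coeFn_add U V).trans (hg.add hk), fun m hm x hx => ?_⟩
    rw [Pi.add_apply, Pi.add_apply, hgc m hm x hx, hkc m hm x hx]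
  smul_mem' := by
    rintro c U ⟨g, hg, hgc⟩
    refine ⟨fun x => c * g x, ?_, fun m hm x hx => by simp only [hgc m hm x hx]⟩
    filter_upwards [Lp.coeFn_smul c U, hg] with x h1 h2
    rw [h1, Pi.smul_apply, h2, smul_eq_mul]

theorem isClosed_HXsub (X : L2) : IsClosed (HXsub X : Set L2) := by
  refine IsSeqClosed.isClosed fun Z W hZ hlim => ?_
  obtain ⟨ns, hns⟩ := exists_seq_tendsto_ae_L2 hlim
  choose g hg hgc using hZ
  refine ⟨fun m => limUnder atTop fun i => g (ns i) m, ?_, fun m hm x hx => ?_⟩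
  · filter_upwards [hns, ae_all_iff.2 hg] with x h1 h2
    simp only [h2] at h1
    exact h1.limUnder_eq.symm
  · simp only [fun i => hgc (ns i) m hm x hx]

instance completeSpace_HXsub (X : L2) : CompleteSpace (HXsub X) :=
  (isClosed_HXsub X).completeSpace_coe

theorem isProjHX_starProjection (X V : L2) : IsProjHX X V ((HXsub X).starProjection V) :=
  ⟨(HXsub X).starProjection_apply_mem V,
    fun U hU => (HXsub X).starProjection_inner_eq_zero V U hU⟩

theorem exists_connectedComponentIn_eq_Ioo {U : Set ℝ} (hU : IsOpen U) (hsub : U ⊆ Omg) {p : ℝ}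
    (hp : p ∈ U) : ∃ a ∈ Icc (0 : ℝ) 1, ∃ b ∈ Icc (0 : ℝ) 1, p ∈ Ioo a b ∧ a ∉ U ∧ b ∉ U ∧
      connectedComponentIn U p = Ioo a b := by
  set S := connectedComponentIn U p with hS
  have hpS : p ∈ S := mem_connectedComponentIn hp
  have hSO : S ⊆ Ioo 0 1 := (connectedComponentIn_subset U p).trans hsub
  have hbb : BddBelow S := bddBelow_Ioo.mono hSO
  have hba : BddAbove S := bddAbove_Ioo.mono hSO
  have hSopen : IsOpen S := hU.connectedComponentIn
  have hSeq : S = Ioo (sInf S) (sSup S) := by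
    refine Subset.antisymm ?_
      (IsConnected.Ioo_csInf_csSup_subset ⟨⟨p, hpS⟩, isPreconnected_connectedComponentIn⟩ hbb hba)
    rw [← interior_Icc]
    exact interior_maximal (subset_Icc_csInf_csSup hbb hba) hSopen
  generalize sInf S = a at hSeq
  generalize sSup S = b at hSeq
  have hpab : p ∈ Ioo a b := hSeq ▸ hpS
  have hlt : a < b := hpab.1.trans hpab.2
  obtain ⟨ha, hb⟩ := (Ioo_subset_Ioo_iff hlt).1 (hSeq ▸ hSO)
  have hnot : ∀ e ∈ Icc a b, e ∉ Ioo a b → e ∉ U := by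
    intro e he heab heU
    rw [← closure_Ioo hlt.ne, mem_closure_iff] at he
    obtain ⟨z, hz1, hz2⟩ := he _ hU.connectedComponentIn (mem_connectedComponentIn heU)
    rw [← hSeq, hS] at hz2 heab
    rw [connectedComponentIn_eq hz2, ← connectedComponentIn_eq hz1] at heab
    exact heab (mem_connectedComponentIn heU)
  exact ⟨a, ⟨ha, hlt.le.trans hb⟩, b, ⟨ha.trans hlt.le, hb⟩, hpab,
    hnot a (left_mem_Icc.2 hlt.le) (by simp), hnot b (right_mem_Icc.2 hlt.le) (by simp), hSeq⟩

theorem stepFn_mem_HX {X : L2} {a : ℝ} (ha : a ∉ OmegaX X) : stepFn a ∈ HX X := by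
  refine ⟨_, stepFn_coe a, fun m hm x hx => ?_⟩
  have hord : OrdConnected (connectedComponentIn (OmegaX X) m) :=
    isPreconnected_connectedComponentIn.ordConnected
  have hmm := mem_connectedComponentIn hm
  have hna : a ∉ connectedComponentIn (OmegaX X) m :=
    fun h => ha (connectedComponentIn_subset _ _ h)
  have : a < x ↔ a < m := by
    constructor
    · intro h
      by_contra! h'
      exact hna (hord.out hmm hx ⟨h', h.le⟩)
    · intro h
      by_contra! h'
      exact hna (hord.out hx hmm ⟨h', h.le⟩)
  simp only [indicator, mem_Ioi, this]

theorem integral_le_of_ae_le (W : L2) {a b c : ℝ} (ha : 0 ≤ a) (hab : a ≤ b) (hb : b ≤ 1)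
    (h : ∀ᵐ x ∂mu, x ∈ Ioo a b → W x ≤ c) : ∫ x in a..b, W x ≤ c * (b - a) := by
  have hc : ∫ _ in a..b, c = c * (b - a) := by simp [mul_comm]
  rw [← hc]
  refine intervalIntegral.integral_mono_ae_restrict hab (intervalIntegrable_L2 W ha hab hb)
    intervalIntegrable_const ?_
  rw [← restrict_Ioo_eq_restrict_Icc]
  filter_upwards [ae_restrict_of_ae_restrict_of_subset (Ioo_subset_Ioo ha hb) h,
    ae_restrict_mem measurableSet_Ioo] with x h1 h2
  exact h1 h2

theorem le_integral_of_le_ae (W : L2) {a b c : ℝ} (ha : 0 ≤ a) (hab : a ≤ b) (hb : b ≤ 1)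
    (h : ∀ᵐ x ∂mu, x ∈ Ioo a b → c ≤ W x) : c * (b - a) ≤ ∫ x in a..b, W x := by
  have hc : ∫ _ in a..b, c = c * (b - a) := by simp [mul_comm]
  rw [← hc]
  refine intervalIntegral.integral_mono_ae_restrict hab intervalIntegrable_const
    (intervalIntegrable_L2 W ha hab hb) ?_
  rw [← restrict_Ioo_eq_restrict_Icc]
  filter_upwards [ae_restrict_of_ae_restrict_of_subset (Ioo_subset_Ioo ha hb) h,
    ae_restrict_mem measurableSet_Ioo] with x h1 h2
  exact h1 h2

/-- The projection of a step onto `HX X` is a convex combination of two steps in `HX X`. -/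
theorem exists_starProjection_stepFn (X : L2) {p : ℝ} (hp : p ∈ Icc (0 : ℝ) 1) :
    ∃ θ ∈ Icc (0 : ℝ) 1, ∃ a ∈ Icc (0 : ℝ) 1, ∃ b ∈ Icc (0 : ℝ) 1,
      a ∉ OmegaX X ∧ b ∉ OmegaX X ∧
      (HXsub X).starProjection (stepFn p) = θ • stepFn a + (1 - θ) • stepFn b ∧
      ∀ Z ∈ Kcone, 0 ≤ ⟪Z, stepFn p - (HXsub X).starProjection (stepFn p)⟫ := by
  by_cases hpX : p ∈ OmegaX X
  · obtain ⟨a, ha, b, hb, ⟨hap, hpb⟩, haX, hbX, hcomp⟩ :=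
      exists_connectedComponentIn_eq_Ioo (isOpen_OmegaX X) (fun _ h => h.1) hpX
    have hba : 0 < b - a := by linarith
    set θ := (b - p) / (b - a) with hθ
    have hθ1 : 1 - θ = (p - a) / (b - a) := by rw [hθ]; field_simp; ring
    have hθ0 : 0 ≤ θ := div_nonneg (by linarith) hba.le
    have hθ1' : 0 ≤ 1 - θ := by rw [hθ1]; exact div_nonneg (by linarith) hba.le
    have hmul : θ * (p - a) = (1 - θ) * (b - p) := by rw [hθ1, hθ]; ring
    have hinner : ∀ U : L2, ⟪U, stepFn p - (θ • stepFn a + (1 - θ) • stepFn b)⟫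
        = (1 - θ) * (∫ x in p..b, U x) - θ * ∫ x in a..p, U x := by
      intro U
      rw [← inner_stepFn_sub U ha.1 hap.le hp.2, ← inner_stepFn_sub U hp.1 hpb.le hb.2,
        inner_sub_right, inner_add_right, real_inner_smul_right, real_inner_smul_right]
      ring
    have hmem : ∀ x ∈ Ioo a b, x ∈ connectedComponentIn (OmegaX X) p := fun x hx => hcomp ▸ hx
    have hproj : (HXsub X).starProjection (stepFn p) = θ • stepFn a + (1 - θ) • stepFn b := by
      refine Submodule.eq_starProjection_of_mem_of_inner_eq_zero
        (add_mem (Submodule.smul_mem _ _ (stepFn_mem_HX haX))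
          (Submodule.smul_mem _ _ (stepFn_mem_HX hbX))) ?_
      rintro U ⟨g, hUg, hgc⟩
      have hU : ∀ᵐ x ∂mu, x ∈ Ioo a b → U x = g p := by
        filter_upwards [hUg] with x h1 h2
        rw [h1, hgc p hpX x (hmem x h2)]
      have e1 : ∫ x in a..p, U x = g p * (p - a) := le_antisymm
        (integral_le_of_ae_le U ha.1 hap.le hp.2
          (hU.mono fun x h hx => (h ⟨hx.1, hx.2.trans hpb⟩).le))
        (le_integral_of_le_ae U ha.1 hap.le hp.2
          (hU.mono fun x h hx => (h ⟨hx.1, hx.2.trans hpb⟩).ge))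
      have e2 : ∫ x in p..b, U x = g p * (b - p) := le_antisymm
        (integral_le_of_ae_le U hp.1 hpb.le hb.2
          (hU.mono fun x h hx => (h ⟨hap.trans hx.1, hx.2⟩).le))
        (le_integral_of_le_ae U hp.1 hpb.le hb.2
          (hU.mono fun x h hx => (h ⟨hap.trans hx.1, hx.2⟩).ge))
      rw [real_inner_comm, hinner, e1, e2]
      linear_combination -(g p) * hmul
    refine ⟨θ, ⟨hθ0, by linarith⟩, a, ha, b, hb, haX, hbX, hproj, ?_⟩
    rintro Z ⟨g, hg, hZg⟩
    have e1 : ∫ x in a..p, Z x ≤ g p * (p - a) := by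
      refine integral_le_of_ae_le Z ha.1 hap.le hp.2 ?_
      filter_upwards [hZg] with x h1 h2
      rw [h1]
      exact hg ⟨ha.1.trans_lt h2.1, h2.2.trans_le hp.2⟩ hpX.1 h2.2.le
    have e2 : g p * (b - p) ≤ ∫ x in p..b, Z x := by
      refine le_integral_of_le_ae Z hp.1 hpb.le hb.2 ?_
      filter_upwards [hZg] with x h1 h2
      rw [h1]
      exact hg hpX.1 ⟨hp.1.trans_lt h2.1, h2.2.trans_le hb.2⟩ h2.1.le
    rw [hproj, hinner]
    have e3 := mul_le_mul_of_nonneg_left e1 hθ0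
    have e4 := mul_le_mul_of_nonneg_left e2 hθ1'
    have e5 : θ * (g p * (p - a)) = (1 - θ) * (g p * (b - p)) := by
      linear_combination (g p) * hmul
    linarith
  · have hproj : (HXsub X).starProjection (stepFn p) = stepFn p :=
      Submodule.starProjection_eq_self_iff.2 (stepFn_mem_HX hpX)
    refine ⟨1, right_mem_Icc.2 zero_le_one, p, hp, p, hp, hpX, hpX, ?_, fun Z _ => ?_⟩
    · rw [hproj]; simp
    · rw [hproj]; simp

theorem strict_of_notMem_OmegaX {X : L2} {g : ℝ → ℝ} (hg : MonotoneOn g Omg)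
    (hXg : ⇑X =ᵐ[mu] g) {a : ℝ} (haO : a ∈ Omg) (ha : a ∉ OmegaX X) :
    (∀ x ∈ Omg, a < x → g a < g x) ∨ ∀ x ∈ Omg, x < a → g x < g a := by
  by_contra! h
  obtain ⟨⟨x, hxO, hax, hx⟩, y, hyO, hya, hy⟩ := h
  refine ha (mem_OmegaX_of_mem_nhds hXg haO (isOpen_Ioo.mem_nhds ⟨hya, hax⟩) (c := g a) ?_)
  intro z hz
  have hzO : z ∈ Omg := ⟨hyO.1.trans hz.1, hz.2.trans hxO.2⟩
  exact le_antisymm ((hg hzO hxO hz.2.le).trans hx) (hy.trans (hg hyO hzO hz.1.le))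

/-- Truncation to `[0, 1]`. -/
def clamp (u : ℝ) : ℝ := max 0 (min 1 u)

theorem abs_clamp_le (u : ℝ) : |clamp u| ≤ 1 := by
  rw [clamp, abs_of_nonneg (le_max_left _ _)]
  exact max_le zero_le_one (min_le_left _ _)

theorem clamp_of_nonpos {u : ℝ} (h : u ≤ 0) : clamp u = 0 :=
  max_eq_left ((min_le_right _ _).trans h)

theorem clamp_of_one_le {u : ℝ} (h : 1 ≤ u) : clamp u = 1 := by
  rw [clamp, min_eq_left h, max_eq_right zero_le_one]

theorem continuous_clamp : Continuous clamp := by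
  unfold clamp; fun_prop

theorem clamp_sub_clamp_le {u v : ℝ} (h : u ≤ v) : clamp v - clamp u ≤ v - u := by
  simp only [clamp, max_def, min_def]
  split_ifs <;> linarith

theorem inner_nonpos_of_mem_normalCone {X N : L2} (hX : X ∈ Kcone) (hN : N ∈ normalCone X)
    {Z : L2} (hZ : Z ∈ Kcone) : ⟪N, Z⟫ ≤ 0 := by
  simpa using hN (X + Z) (add_mem_Kcone hX hZ)

theorem inner_self_nonneg_of_mem_normalCone {X N : L2} (hN : N ∈ normalCone X) :
    0 ≤ ⟪N, X⟫ := by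
  simpa using hN 0 zero_mem_Kcone

theorem tendsto_clamp_atTop {σ d e : ℝ} (h1 : 0 < d → e = 1) (h2 : d < 0 → e = 0)
    (h3 : d = 0 → clamp σ = e) :
    Tendsto (fun n : ℕ => clamp (σ + n * d)) atTop (nhds e) := by
  rcases lt_trichotomy d 0 with hd | hd | hd
  · rw [h2 hd]
    refine tendsto_const_nhds.congr' ?_
    have : Tendsto (fun n : ℕ => σ + n * d) atTop atBot :=
      tendsto_atBot_add_const_left _ _ (tendsto_natCast_atTop_atTop.atTop_mul_const_of_neg hd)
    filter_upwards [this.eventually_le_atBot 0] with n hn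
    exact (clamp_of_nonpos hn).symm
  · simp [hd, h3 hd]
  · rw [h1 hd]
    refine tendsto_const_nhds.congr' ?_
    have : Tendsto (fun n : ℕ => σ + n * d) atTop atTop :=
      tendsto_atTop_add_const_left _ _ (tendsto_natCast_atTop_atTop.atTop_mul_const hd)
    filter_upwards [this.eventually_ge_atTop 1] with n hn
    exact (clamp_of_one_le hn).symm

theorem inner_stepFn_eq_zero_of_mem_normalCone {X N : L2} (hX : X ∈ Kcone)
    (hN : N ∈ normalCone X) {a : ℝ} (ha : a ∈ Icc (0 : ℝ) 1) (haX : a ∉ OmegaX X) :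
    ⟪N, stepFn a⟫ = 0 := by
  have hle := inner_nonpos_of_mem_normalCone hX hN (stepFn_mem_Kcone a)
  rcases ha.1.eq_or_lt with rfl | ha0
  · have := inner_nonpos_of_mem_normalCone hX hN neg_stepFn_zero_mem_Kcone
    rw [inner_neg_right] at this
    linarith
  rcases ha.2.eq_or_lt with rfl | ha1
  · rw [stepFn_one, inner_zero_right]
  have haO : a ∈ Omg := ⟨ha0, ha1⟩
  have hXK := hX
  obtain ⟨g, hg, hXg⟩ := hX
  obtain ⟨σ, hσ1, hσ2⟩ : ∃ σ : ℝ,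
      (∀ x ∈ Omg, a < x → g a = g x → clamp σ = 1) ∧
      (∀ x ∈ Omg, x < a → g a = g x → clamp σ = 0) := by
    rcases strict_of_notMem_OmegaX hg hXg haO haX with h | h
    · exact ⟨0, fun x hx hax he => absurd he (h x hx hax).ne,
        fun _ _ _ _ => clamp_of_nonpos le_rfl⟩
    · exact ⟨1, fun _ _ _ _ => clamp_of_one_le le_rfl,
        fun x hx hax he => absurd he (h x hx hax).ne'⟩
  have hΦ : ∀ n : ℕ, MemLp (fun x => clamp (σ + n * (X x - g a))) 2 mu := fun n =>
    MemLp.of_bound ((continuous_clamp.comp (by fun_prop :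
      Continuous fun u : ℝ => σ + n * (u - g a))).comp_aestronglyMeasurable
        (Lp.aestronglyMeasurable X)) 1 (Eventually.of_forall fun _ => abs_clamp_le _)
  have hG : MemLp (fun _ : ℝ => (1 : ℝ)) 2 mu := memLp_const 1
  have hK : ∀ n : ℕ, (n : ℝ) • X - (hΦ n).toLp ∈ Kcone := by
    intro n
    refine ⟨fun x => n * g x - clamp (σ + n * (g x - g a)), fun x hx y hy hxy => ?_, ?_⟩
    · have h1 : (n : ℝ) * g x ≤ n * g y := by gcongr; exact hg hx hy hxy
      have h2 := clamp_sub_clamp_le (u := σ + n * (g x - g a)) (v := σ + n * (g y - g a))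
        (by linarith)
      simp only
      linarith
    · filter_upwards [Lp.coeFn_sub ((n : ℝ) • X) (hΦ n).toLp, Lp.coeFn_smul (n : ℝ) X,
        (hΦ n).coeFn_toLp, hXg] with x h1 h2 h3 h4
      rw [h1, Pi.sub_apply, h2, h3, Pi.smul_apply, h4, smul_eq_mul]
  refine le_antisymm hle (ge_of_tendsto' (tendsto_inner_of_dominated N
    (Φ := fun n => (hΦ n).toLp) (G := hG.toLp) (fun n => ?_) ?_) fun n => ?_)
  · filter_upwards [(hΦ n).coeFn_toLp, hG.coeFn_toLp] with x h1 h2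
    rw [h1, h2]
    exact abs_clamp_le _
  · have hne : ∀ᵐ x ∂mu, x ≠ a := by simp [ae_iff]
    filter_upwards [ae_all_iff.2 fun n => (hΦ n).coeFn_toLp, stepFn_coe a, hXg, ae_mem_Omg, hne]
      with x h1 h2 h3 h4 h5
    simp only [h1, h2, h3]
    rcases lt_or_gt_of_ne h5 with hx | hx
    · rw [indicator_of_notMem (by simpa using hx.le)]
      refine tendsto_clamp_atTop (fun h => ?_) (fun _ => rfl)
        fun h => hσ2 x h4 hx (by linarith)
      linarith [hg h4 haO hx.le]
    · rw [indicator_of_mem (by simpa using hx)]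
      refine tendsto_clamp_atTop (fun _ => rfl) (fun h => ?_)
        fun h => hσ1 x h4 hx (by linarith)
      linarith [hg haO h4 hx.le]
  · have h1 := inner_nonpos_of_mem_normalCone hXK hN (hK n)
    have h2 := mul_nonneg (Nat.cast_nonneg n : (0 : ℝ) ≤ n)
      (inner_self_nonneg_of_mem_normalCone hN)
    rw [inner_sub_right, real_inner_smul_right] at h1
    linarith

theorem inner_starProjection_eq_zero_of_mem_normalCone {X N : L2} (hX : X ∈ Kcone)
    (hN : N ∈ normalCone X) {Z : L2} (hZ : Z ∈ Kcone) :
    ⟪N, (HXsub X).starProjection Z⟫ = 0 := by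
  have hstep : ∀ p ∈ Icc (0 : ℝ) 1, ⟪(HXsub X).starProjection N, stepFn p⟫ = 0 := by
    intro p hp
    obtain ⟨θ, -, a, ha, b, hb, haX, hbX, hproj, -⟩ := exists_starProjection_stepFn X hp
    rw [Submodule.inner_starProjection_left_eq_right, hproj, inner_add_right,
      real_inner_smul_right, real_inner_smul_right,
      inner_stepFn_eq_zero_of_mem_normalCone hX hN ha haX,
      inner_stepFn_eq_zero_of_mem_normalCone hX hN hb hbX]
    simp
  have h0 := hstep 0 (left_mem_Icc.2 zero_le_one)
  rw [← Submodule.inner_starProjection_left_eq_right]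
  refine le_antisymm (inner_nonpos_of_stepFn h0 (fun p hp => (hstep p hp).le) hZ) ?_
  have := inner_nonpos_of_stepFn (W := -(HXsub X).starProjection N)
    (by rw [inner_neg_left, h0, neg_zero])
    (fun p hp => by rw [inner_neg_left, hstep p hp, neg_zero]) hZ
  rw [inner_neg_left] at this
  linarith

theorem zero_notMem_OmegaX (X : L2) : (0 : ℝ) ∉ OmegaX X := fun h => lt_irrefl _ h.1.1

theorem starProjection_stepFn_zero (X : L2) :
    (HXsub X).starProjection (stepFn 0) = stepFn 0 :=
  Submodule.starProjection_eq_self_iff.2 (stepFn_mem_HX (zero_notMem_OmegaX X))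

theorem mem_Kcone_of_polar {Z : L2} (h : ∀ W : L2, (∀ U ∈ Kcone, ⟪W, U⟫ ≤ 0) → ⟪W, Z⟫ ≤ 0) :
    Z ∈ Kcone := by
  obtain ⟨V, hV, hmin⟩ := exists_norm_eq_iInf_of_complete_convex ⟨0, zero_mem_Kcone⟩
    isClosed_Kcone.isComplete convex_Kcone Z
  have hN : Z - V ∈ normalCone V := (norm_eq_iInf_iff_real_inner_le_zero convex_Kcone hV).1 hmin
  have h1 := h (Z - V) fun U hU => inner_nonpos_of_mem_normalCone hV hN hU
  have h2 := inner_self_nonneg_of_mem_normalCone hN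
  have h3 : ⟪Z - V, Z - V⟫ ≤ 0 := by rw [inner_sub_right]; linarith
  rw [sub_eq_zero.1 (real_inner_self_nonpos.1 h3)]
  exact hV

theorem starProjection_mem_Kcone (X : L2) {Z : L2} (hZ : Z ∈ Kcone) :
    (HXsub X).starProjection Z ∈ Kcone := by
  refine mem_Kcone_of_polar fun W hW => ?_
  rw [← Submodule.inner_starProjection_left_eq_right]
  refine inner_nonpos_of_stepFn ?_ (fun p hp => ?_) hZ
  · rw [Submodule.inner_starProjection_left_eq_right, starProjection_stepFn_zero]
    have h1 := hW _ (stepFn_mem_Kcone 0)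
    have h2 := hW _ neg_stepFn_zero_mem_Kcone
    rw [inner_neg_right] at h2
    linarith
  · obtain ⟨θ, hθ, a, -, b, -, -, -, hproj, -⟩ := exists_starProjection_stepFn X hp
    rw [Submodule.inner_starProjection_left_eq_right, hproj]
    exact hW _ (add_mem_Kcone (smul_mem_Kcone (stepFn_mem_Kcone a) hθ.1)
      (smul_mem_Kcone (stepFn_mem_Kcone b) (sub_nonneg.2 hθ.2)))

theorem inner_sub_starProjection_nonneg (X : L2) {Z W : L2} (hZ : Z ∈ Kcone) (hW : W ∈ Kcone) :
    0 ≤ ⟪W, Z - (HXsub X).starProjection Z⟫ := by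
  rw [← inner_sub_starProjection_comm, ← neg_nonpos, ← inner_neg_left]
  refine inner_nonpos_of_stepFn ?_ (fun p hp => ?_) hZ
  · rw [inner_neg_left, inner_sub_starProjection_comm, starProjection_stepFn_zero, sub_self,
      inner_zero_right, neg_zero]
  · obtain ⟨-, -, -, -, -, -, -, -, -, h⟩ := exists_starProjection_stepFn X hp
    rw [inner_neg_left, inner_sub_starProjection_comm, neg_nonpos]
    exact h W hW

theorem isStickyFamily_Kcone : IsStickyFamily Kcone HXsub where
  closed := isClosed_Kcone
  convex := convex_Kcone
  nonempty := ⟨0, zero_mem_Kcone⟩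
  mem_self _ hX := mem_HX_self hX
  proj_mem X _ _ hZ := starProjection_mem_Kcone X hZ
  inner_nonneg X _ _ hZ _ hW := inner_sub_starProjection_nonneg X hZ hW
  normal_le _ hX _ hN _ hZ := inner_nonpos_of_mem_normalCone hX hN hZ
  normal_proj _ hX _ hN _ hZ := inner_starProjection_eq_zero_of_mem_normalCone hX hN hZ
  mono _ _ _ _ h := HX_subset_of_OmegaX_subset (OmegaX_subset_of_mem_HX h)

theorem Sticking.isAdmissible {F : L2 → L2} (hF : Sticking F) {X : L2} (hX : X ∈ Kcone) :
    IsAdmissible Kcone HXsub X (F X) := by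
  intro Z hZ
  have h := hF X hX 0 zero_mem_Kcone (HXsub X).zero_mem _ (isProjHX_starProjection X (F X)) Z hZ
  rwa [sub_zero, inner_sub_starProjection_comm] at h

theorem LagSol.isLagrangianOn {F : L2 → L2} {L : ℝ≥0} (hLip : LipschitzOnWith L F Kcone)
    {Xbar Vbar : L2} {X : ℝ → L2} (hX : LagSol F Xbar Vbar X) {T : ℝ} (hT : 0 ≤ T) :
    ∃ M, IsLagrangianOn Kcone F X (fun t => Vbar + ∫ s in Ioc (0 : ℝ) t, F (X s)) T M := by
  obtain ⟨hmem, -, hXLip, hder⟩ := hX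
  obtain ⟨L', hL'⟩ := hXLip T
  have hFX : ContinuousOn (fun t => F (X t)) (Icc 0 T) :=
    hLip.continuousOn.comp hL'.continuousOn fun t ht => hmem t ht.1
  obtain ⟨B, hB⟩ := isCompact_Icc.exists_bound_of_continuousOn hFX
  have hB0 : 0 ≤ B := (norm_nonneg _).trans (hB 0 (left_mem_Icc.2 hT))
  have hint : ∀ {s t : ℝ}, 0 ≤ s → s ≤ t → t ≤ T →
      IntervalIntegrable (fun q => F (X q)) volume s t := fun hs hst ht =>
    (hFX.mono (Icc_subset_Icc hs ht)).intervalIntegrable_of_Icc hst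
  have hY : ∀ {s t : ℝ}, 0 ≤ s → s ≤ t → t ≤ T →
      (Vbar + ∫ q in Ioc (0 : ℝ) t, F (X q)) - (Vbar + ∫ q in Ioc (0 : ℝ) s, F (X q))
        = ∫ q in s..t, F (X q) := by
    intro s t hs hst ht
    rw [← intervalIntegral.integral_of_le (hs.trans hst), ← intervalIntegral.integral_of_le hs,
      add_sub_add_left_eq_sub, intervalIntegral.integral_interval_sub_left
        (hint le_rfl (hs.trans hst) ht) (hint le_rfl hs (hst.trans ht))]
  have hYle : ∀ {s t : ℝ}, 0 ≤ s → s ≤ t → t ≤ T →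
      ‖(Vbar + ∫ q in Ioc (0 : ℝ) t, F (X q)) - (Vbar + ∫ q in Ioc (0 : ℝ) s, F (X q))‖
        ≤ B * (t - s) := by
    intro s t hs hst ht
    rw [hY hs hst ht, ← abs_of_nonneg (sub_nonneg.2 hst)]
    refine intervalIntegral.norm_integral_le_of_norm_le_const fun q hq => ?_
    rw [uIoc_of_le hst] at hq
    exact hB q ⟨hs.trans hq.1.le, hq.2.trans ht⟩
  have hV0 := norm_nonneg Vbar
  have hL0 := L.coe_nonneg
  have hL'0 := L'.coe_nonneg
  have hBT := mul_nonneg hB0 hT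
  refine ⟨1 + L' + B + L + ‖Vbar‖ + B * T, ?_⟩
  constructor
  · linarith
  · exact fun t ht => hmem t ht.1
  · intro s hs t ht
    have h := hL'.dist_le_mul s hs t ht
    rw [dist_eq_norm, Real.dist_eq] at h
    exact h.trans (mul_le_mul_of_nonneg_right (by linarith) (abs_nonneg _))
  · intro s hs t ht
    have key : ‖(Vbar + ∫ q in Ioc (0 : ℝ) s, F (X q)) - (Vbar + ∫ q in Ioc (0 : ℝ) t, F (X q))‖
        ≤ B * |s - t| := by
      rcases le_total s t with hst | hst
      · rw [norm_sub_rev, abs_sub_comm, abs_of_nonneg (sub_nonneg.2 hst)]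
        exact hYle hs.1 hst ht.2
      · rw [abs_of_nonneg (sub_nonneg.2 hst)]
        exact hYle ht.1 hst hs.2
    exact key.trans (mul_le_mul_of_nonneg_right (by linarith) (abs_nonneg _))
  · intro t ht
    have h := hYle le_rfl ht.1 ht.2
    have h1 : B * (t - 0) ≤ B * T := mul_le_mul_of_nonneg_left (by linarith [ht.2]) hB0
    have h2 := norm_le_insert' (Vbar + ∫ q in Ioc (0 : ℝ) t, F (X q))
      (Vbar + ∫ q in Ioc (0 : ℝ) 0, F (X q))
    have h3 : ‖Vbar + ∫ q in Ioc (0 : ℝ) 0, F (X q)‖ = ‖Vbar‖ := by simp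
    linarith
  · intro U hU V hV
    have h := hLip.dist_le_mul U hU V hV
    rw [dist_eq_norm, dist_eq_norm] at h
    exact h.trans (mul_le_mul_of_nonneg_right (by linarith) (norm_nonneg _))
  · intro s t hs hst ht U _ δ hδ
    have e : (∫ q in s..t, F (X q)) - (t - s) • F U = ∫ q in s..t, (F (X q) - F U) := by
      rw [intervalIntegral.integral_sub (hint hs hst ht) intervalIntegrable_const,
        intervalIntegral.integral_const]
    rw [hY hs hst ht, e, mul_comm, ← abs_of_nonneg (sub_nonneg.2 hst)]
    refine intervalIntegral.norm_integral_le_of_norm_le_const fun q hq => ?_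
    rw [uIoc_of_le hst] at hq
    exact hδ q ⟨hq.1.le, hq.2⟩
  · filter_upwards [(ae_restrict_iff' measurableSet_Ioi).1 hder] with t ht htT
    exact ht htT.1

/-- **Sticking forces yield sticky Lagrangian solutions.** If `F` is
Lipschitz (and linearly bounded) and sticking, then every Lagrangian solution with initial
data `X̄ ∈ K`, `V̄ ∈ H_{X̄}` is sticky: `Ω_{X(t₁)} ⊆ Ω_{X(t₂)}` for `0 ≤ t₁ ≤ t₂`. -/
theorem stmt14 (F : L2 → L2) (L : ℝ≥0) (hLip : LipschitzOnWith L F Kcone)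
    (C : ℝ) (hC : 0 ≤ C) (hbd : ∀ X ∈ Kcone, ‖F X‖ ≤ C * (1 + ‖X‖))
    (hstick : Sticking F)
    (Xbar : L2) (hXbar : Xbar ∈ Kcone) (Vbar : L2) (hVbar : Vbar ∈ HX Xbar)
    (X : ℝ → L2) (hX : LagSol F Xbar Vbar X) :
    ∀ t₁ t₂ : ℝ, 0 ≤ t₁ → t₁ ≤ t₂ → OmegaX (X t₁) ⊆ OmegaX (X t₂) := by
  intro t₁ t₂ h0 h12
  obtain ⟨M, hM⟩ := hX.isLagrangianOn hLip (h0.trans h12)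
  refine OmegaX_subset_of_mem_HX (hM.mem_of_le isStickyFamily_Kcone
    (fun _ hU => hstick.isAdmissible hU) ?_ h0 h12 le_rfl)
  simpa [hX.2.1] using (show Vbar ∈ HXsub Xbar from hVbar)
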